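/- (Theorem 4, actor-equivalence part, example-based control / RCE setting.) In addition to the hypotheses of the RCE fixed-point result, assume p_e s > 0 for all s. Let Q̃^β be the unique fixed point of (T_β^E Q̃)(s,a) = (1-γ) · p_e s + γ · ∑_{s'} P s a s' · ∑_{a'} β s' a' · Q̃(s',a'), and let Q* be the unique fixed point of (U Q)(s,a) = ( (1-γ) · p_e s + γ · ∑_{s'} P s a s' · ∑_{a'} π s' a' · Q(s',a') ) · (β s a / π s a). Then for every state s: ∑_{a} π s a · Real.log (Q*(s,a)) = ∑_{a} π s a · ( Real.log (Q̃^β(s,a)) + Real.log (β s a) - Real.log (π s a) ). -/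

import Mathlib

open Finset

/-- Minimum principle for the discounted expectation operator of a policy `β`. -/
lemma nonneg_of_discounted_expectation_le
    {S A : Type*} [Fintype S] [Fintype A]
    {P : S → A → S → ℝ} (hP0 : ∀ s a s', 0 ≤ P s a s') (hP1 : ∀ s a, ∑ s', P s a s' = 1)
    {β : S → A → ℝ} (hβ0 : ∀ s a, 0 ≤ β s a) (hβ1 : ∀ s, ∑ a, β s a = 1)
    {γ : ℝ} (hγ0 : 0 ≤ γ) (hγ1 : γ < 1) {f : S × A → ℝ}
    (hf : ∀ s a, γ * ∑ s', P s a s' * ∑ a', β s' a' * f (s', a') ≤ f (s, a)) (x : S × A) :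
    0 ≤ f x := by
  have : Nonempty (S × A) := ⟨x⟩
  obtain ⟨⟨s, a⟩, hmin⟩ := Finite.exists_min f
  have hinner (s' : S) : f (s, a) ≤ ∑ a', β s' a' * f (s', a') :=
    calc f (s, a) = ∑ a', β s' a' * f (s, a) := by rw [← Finset.sum_mul, hβ1, one_mul]
      _ ≤ _ := Finset.sum_le_sum fun a' _ => mul_le_mul_of_nonneg_left (hmin _) (hβ0 _ _)
  have houter : f (s, a) ≤ ∑ s', P s a s' * ∑ a', β s' a' * f (s', a') :=
    calc f (s, a) = ∑ s', P s a s' * f (s, a) := by rw [← Finset.sum_mul, hP1, one_mul]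
      _ ≤ _ := Finset.sum_le_sum fun s' _ => mul_le_mul_of_nonneg_left (hinner _) (hP0 _ _ _)
  have hγ := (mul_le_mul_of_nonneg_left houter hγ0).trans (hf s a)
  refine le_trans ?_ (hmin x)
  by_contra! hneg
  nlinarith

/-- The Bellman evaluation equation of a policy `β` has at most one solution. -/
lemma bellman_solution_unique
    {S A : Type*} [Fintype S] [Fintype A]
    {P : S → A → S → ℝ} (hP0 : ∀ s a s', 0 ≤ P s a s') (hP1 : ∀ s a, ∑ s', P s a s' = 1)
    {β : S → A → ℝ} (hβ0 : ∀ s a, 0 ≤ β s a) (hβ1 : ∀ s, ∑ a, β s a = 1)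
    {γ : ℝ} (hγ0 : 0 ≤ γ) (hγ1 : γ < 1) {r : S → A → ℝ} {f g : S × A → ℝ}
    (hf : ∀ s a, f (s, a) = r s a + γ * ∑ s', P s a s' * ∑ a', β s' a' * f (s', a'))
    (hg : ∀ s a, g (s, a) = r s a + γ * ∑ s', P s a s' * ∑ a', β s' a' * g (s', a')) :
    f = g := by
  funext x
  have hle {u v : S × A → ℝ}
      (hu : ∀ s a, u (s, a) = r s a + γ * ∑ s', P s a s' * ∑ a', β s' a' * u (s', a'))
      (hv : ∀ s a, v (s, a) = r s a + γ * ∑ s', P s a s' * ∑ a', β s' a' * v (s', a')) :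
      v x ≤ u x := by
    refine sub_nonneg.mp (nonneg_of_discounted_expectation_le (f := fun y => u y - v y)
      hP0 hP1 hβ0 hβ1 hγ0 hγ1 (fun s a => ?_) x)
    simp only [mul_sub, Finset.sum_sub_distrib]
    linarith [hu s a, hv s a]
  exact le_antisymm (hle hg hf) (hle hf hg)

/-- Theorem 4 (actor-equivalence part, example-based control / RCE):
critic-regularized RCE yields the same actor objective as one-step RL with a
reverse-KL penalty toward `β`. -/
theorem rce_one_step_rl_eq_critic_regularization
    {S A : Type*} [Fintype S] [Fintype A] [Nonempty S] [Nonempty A]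
    (P : S → A → S → ℝ) (hP0 : ∀ s a s', 0 ≤ P s a s')
    (hP1 : ∀ s a, ∑ s', P s a s' = 1)
    (pe : S → ℝ) (hpe : ∀ s, 0 < pe s)
    (β : S → A → ℝ) (hβ0 : ∀ s a, 0 < β s a) (hβ1 : ∀ s, ∑ a, β s a = 1)
    (π : S → A → ℝ) (hπ0 : ∀ s a, 0 < π s a) (hπ1 : ∀ s, ∑ a, π s a = 1)
    (γ : ℝ) (hγ0 : 0 ≤ γ) (hγ1 : γ < 1)
    (Qβ : S × A → ℝ)
    (hQβ : ∀ s a, Qβ (s, a) =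
      (1 - γ) * pe s + γ * ∑ s', P s a s' * ∑ a', β s' a' * Qβ (s', a'))
    (Qstar : S × A → ℝ)
    (hQstar : ∀ s a, Qstar (s, a) =
      ((1 - γ) * pe s + γ * ∑ s', P s a s' * ∑ a', π s' a' * Qstar (s', a'))
        * (β s a / π s a)) :
    ∀ s, ∑ a, π s a * Real.log (Qstar (s, a)) =
      ∑ a, π s a * (Real.log (Qβ (s, a)) + Real.log (β s a) - Real.log (π s a)) := by
  have hβ0' s a := (hβ0 s a).le
  have hr (s : S) : 0 < (1 - γ) * pe s := mul_pos (sub_pos.mpr hγ1) (hpe s)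
  have hQβ_nonneg : ∀ x, 0 ≤ Qβ x :=
    nonneg_of_discounted_expectation_le hP0 hP1 hβ0' hβ1 hγ0 hγ1
      fun s a => by linarith [hQβ s a, hr s]
  have hQβ_pos (s : S) (a : A) : 0 < Qβ (s, a) := by
    rw [hQβ]
    refine add_pos_of_pos_of_nonneg (hr s) (mul_nonneg hγ0 ?_)
    exact Finset.sum_nonneg fun s' _ => mul_nonneg (hP0 _ _ _) <|
      Finset.sum_nonneg fun a' _ => mul_nonneg (hβ0' _ _) (hQβ_nonneg _)
  have hscaled : (fun x : S × A => Qstar x * (π x.1 x.2 / β x.1 x.2)) = Qβ := by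
    refine bellman_solution_unique hP0 hP1 hβ0' hβ1 hγ0 hγ1 (fun s a => ?_) hQβ
    have hcancel (s' : S) (a' : A) :
        β s' a' * (Qstar (s', a') * (π s' a' / β s' a')) = π s' a' * Qstar (s', a') := by
      field_simp [(hβ0 s' a').ne']
    simp only [hcancel]
    rw [hQstar s a, mul_assoc, div_mul_div_cancel₀ (hπ0 s a).ne', div_self (hβ0 s a).ne',
      mul_one]
  intro s
  refine Finset.sum_congr rfl fun a _ => ?_
  have hQstar_eq : Qstar (s, a) = Qβ (s, a) * β s a / π s a := by
    have := (hβ0 s a).ne'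
    have := (hπ0 s a).ne'
    rw [← hscaled]
    field_simp
  rw [hQstar_eq, Real.log_div (mul_pos (hQβ_pos s a) (hβ0 s a)).ne' (hπ0 s a).ne',
    Real.log_mul (hQβ_pos s a).ne' (hβ0 s a).ne']
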